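/- There is a universal constant c > 0 such that for every d ≥ 5 and n = 4d − 15 there exist a two-dimensional linear subspace W ⊂ ℝ^d and points ā₁,…,ā_n ∈ ℝ^d with ‖ā_i‖₁ ≤ 1 for all i, with the following property: for every 0 < ε < 1/90 and all points a₁,…,a_n ∈ ℝ^d with ‖a_i − ā_i‖₁ ≤ ε for all i ∈ [n], the polygon conv(a₁,…,a_n) ∩ W has at least c·min(1/√ε, 2^d) edges. -/

import Mathlib

open Set

noncomputable section

abbrev Euc (d : ℕ) := EuclideanSpace ℝ (Fin d)

/-- Number of edges (one-dimensional exposed faces) of a set. -/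
def edgeCount {d : ℕ} (S : Set (Euc d)) : ℕ :=
  Set.ncard {F : Set (Euc d) | IsExposed ℝ S F ∧ Module.finrank ℝ (vectorSpan ℝ F) = 1}

/-- The `ℓ₁` norm on `ℝ^d`. -/
def l1norm {d : ℕ} (x : Euc d) : ℝ := ∑ i, |x i|

section Faces

variable {E ι : Type*} [NormedAddCommGroup E] [NormedSpace ℝ E] [Fintype ι]

theorem mem_convexHull_range_iff_exists_weights {a : ι → E} {x : E} :
    x ∈ convexHull ℝ (range a) ↔
      ∃ w : ι → ℝ, (∀ i, 0 ≤ w i) ∧ ∑ i, w i = 1 ∧ ∑ i, w i • a i = x := by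
  classical
  constructor
  · intro hx
    have h := (Fintype.linearCombination ℝ a).image_convexHull
      (range fun i : ι => (Pi.single i 1 : ι → ℝ))
    rw [← range_comp, convexHull_rangle_single_eq_stdSimplex] at h
    have h2 : (⇑(Fintype.linearCombination ℝ a) ∘ fun i : ι => (Pi.single i 1 : ι → ℝ)) = a := by
      ext i
      simp [Fintype.linearCombination_apply_single]
    rw [h2] at h
    rw [← h] at hx
    obtain ⟨w, ⟨hw0, hw1⟩, rfl⟩ := hx
    exact ⟨w, hw0, hw1, (Fintype.linearCombination_apply ℝ a w).symm⟩
  · rintro ⟨w, hw0, hw1, hx⟩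
    exact mem_convexHull_of_exists_fintype w a hw0 hw1 (fun i => mem_range_self i) hx

/-- The supports of the convex combinations of `a` that represent points of `F`. -/
def representingSupports (a : ι → E) (F : Set E) : Set (Set ι) :=
  {s | ∃ x ∈ F, ∃ w : ι → ℝ, (∀ i, 0 ≤ w i) ∧ ∑ i, w i = 1 ∧ ∑ i, w i • a i = x ∧
    s = {i | w i ≠ 0}}

theorem subset_of_representingSupports_subset {a : ι → E} {W : Submodule ℝ E} {F G : Set E}
    (hF : F ⊆ convexHull ℝ (range a) ∩ W)
    (hG : IsExposed ℝ (convexHull ℝ (range a) ∩ W) G)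
    (h : representingSupports a F ⊆ representingSupports a G) : F ⊆ G := by
  intro x hx
  obtain ⟨w, hw0, hw1, hwx⟩ := mem_convexHull_range_iff_exists_weights.1 (hF hx).1
  obtain ⟨y, hy, v, hv0, hv1, hvy, hs⟩ := h ⟨x, hx, w, hw0, hw1, hwx, rfl⟩
  obtain ⟨l, hl⟩ := hG ⟨y, hy⟩
  have hyl := hy
  rw [hl] at hyl
  have hev : ∀ᶠ δ : ℝ in nhdsWithin 0 (Ioi 0), ∀ i, δ * (w i - v i) ≤ v i := by
    refine Filter.eventually_all.2 fun i => ?_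
    by_cases hvi : v i = 0
    · have hwi : w i = 0 := by
        by_contra hne
        have : i ∈ {i | v i ≠ 0} := hs ▸ hne
        exact this hvi
      exact Filter.Eventually.of_forall fun δ => by simp [hvi, hwi]
    · have hpos : 0 * (w i - v i) < v i := by
        rw [zero_mul]
        exact lt_of_le_of_ne (hv0 i) (Ne.symm hvi)
      have hc : Continuous fun δ : ℝ => δ * (w i - v i) := by fun_prop
      exact ((hc.tendsto 0).eventually (gt_mem_nhds hpos)).filter_mono nhdsWithin_le_nhds
        |>.mono fun δ hδ => hδ.le
  obtain ⟨δ, hδ, hδ0⟩ := (hev.and self_mem_nhdsWithin).exists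
  have hδ0 : 0 < δ := hδ0
  have hz : y - δ • (x - y) ∈ convexHull ℝ (range a) ∩ W := by
    refine ⟨mem_convexHull_range_iff_exists_weights.2
      ⟨fun i => v i - δ * (w i - v i), fun i => sub_nonneg.2 (hδ i), ?_, ?_⟩, ?_⟩
    · rw [Finset.sum_sub_distrib, ← Finset.mul_sum, Finset.sum_sub_distrib, hw1, hv1]
      simp
    · simp only [sub_smul, mul_smul, Finset.sum_sub_distrib, ← Finset.smul_sum, hwx, hvy]
    · exact W.sub_mem hyl.1.2 (W.smul_mem _ (W.sub_mem (hF hx).2 hyl.1.2))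
  have h1 := hyl.2 _ hz
  rw [map_sub, map_smul, map_sub, smul_eq_mul] at h1
  have h2 : l y ≤ l x := by nlinarith
  rw [hl]
  exact ⟨hF hx, fun z hz => (hyl.2 z hz).trans h2⟩

/-- A linear section of a polytope has finitely many exposed faces. -/
theorem finite_exposed_convexHull_range_inter (a : ι → E) (W : Submodule ℝ E) :
    {F : Set E | IsExposed ℝ (convexHull ℝ (range a) ∩ W) F}.Finite := by
  refine Set.Finite.of_finite_image (f := representingSupports a) (Set.toFinite _) ?_
  intro F hF G hG h
  exact Subset.antisymm (subset_of_representingSupports_subset hF.subset hG h.subset)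
    (subset_of_representingSupports_subset hG.subset hF h.symm.subset)

end Faces

section Support

variable {E : Type*} [NormedAddCommGroup E] [NormedSpace ℝ E]

/-- Supporting functional at a radial boundary point of a convex subset of `W` whose interior
relative to `W` contains the origin. -/
theorem exists_support_of_forall_smul_notMem {W : Submodule ℝ E} {S : Set E}
    (hS : Convex ℝ S) {r : ℝ} (hr : 0 < r) (hball : ∀ x ∈ W, ‖x‖ ≤ r → x ∈ S)
    {x : E} (hxW : x ∈ W) (hout : ∀ t : ℝ, 1 < t → t • x ∉ S) :
    ∃ l : StrongDual ℝ E, 0 < l x ∧ ∀ y ∈ S, y ∈ W → l y ≤ l x := by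
  set T : Set W := (↑) ⁻¹' S with hT
  have hTconv : Convex ℝ T := hS.linear_preimage W.subtype
  have h0 : (0 : W) ∈ interior T := by
    rw [mem_interior_iff_mem_nhds]
    filter_upwards [Metric.closedBall_mem_nhds (0 : W) hr] with y hy
    exact hball y y.2 (by simpa using hy)
  have hx : (⟨x, hxW⟩ : W) ∉ interior T := by
    intro hx
    rw [mem_interior_iff_mem_nhds] at hx
    have hc : Continuous fun t : ℝ => t • (⟨x, hxW⟩ : W) := by fun_prop
    have ht : Filter.Tendsto (fun t : ℝ => t • (⟨x, hxW⟩ : W)) (nhdsWithin 1 (Ioi 1))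
        (nhds ⟨x, hxW⟩) := by
      have := hc.tendsto 1
      rw [one_smul] at this
      exact this.mono_left nhdsWithin_le_nhds
    obtain ⟨t, ht1, ht2⟩ := ((ht.eventually hx).and self_mem_nhdsWithin).exists
    exact hout t ht2 ht1
  obtain ⟨f, hf0, hf⟩ := geometric_hahn_banach_of_nonempty_interior_point hTconv hx ⟨0, h0⟩
  obtain ⟨g, hg, -⟩ := exists_extension_norm_eq W f
  refine ⟨g, ?_, fun y hy hyW => ?_⟩
  · obtain ⟨v, hv⟩ : ∃ v, 0 < f v := by
      by_contra! hcon
      refine hf0 (ContinuousLinearMap.ext fun v => le_antisymm (hcon v) ?_)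
      simpa using hcon (-v)
    have hv0 : v ≠ 0 := by
      rintro rfl
      simp at hv
    have hn : 0 < ‖v‖ := norm_pos_iff.2 hv0
    have hmem : (r / ‖v‖) • v ∈ T := by
      refine hball _ (W.smul_mem _ v.2) ?_
      change ‖(r / ‖v‖) • v‖ ≤ r
      rw [norm_smul, Real.norm_of_nonneg (by positivity)]
      field_simp
      exact le_rfl
    have h := hf _ hmem
    rw [map_smul, smul_eq_mul] at h
    have : 0 < r / ‖v‖ * f v := by positivity
    have h2 := hg ⟨x, hxW⟩
    simp only at h2
    linarith
  · have h1 := hg ⟨x, hxW⟩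
    have h2 := hg ⟨y, hyW⟩
    simp only at h1 h2
    rw [h1, h2]
    exact hf ⟨y, hyW⟩ hy

theorem exists_pos_smul_mem_forall_smul_notMem {W : Submodule ℝ E} {S : Set E}
    (hcomp : IsCompact S) {r : ℝ} (hr : 0 < r) (hball : ∀ x ∈ W, ‖x‖ ≤ r → x ∈ S)
    {w : E} (hwW : w ∈ W) (hw : w ≠ 0) :
    ∃ ρ : ℝ, 0 < ρ ∧ ρ • w ∈ S ∧ ∀ t : ℝ, ρ < t → t • w ∉ S := by
  have hn : 0 < ‖w‖ := norm_pos_iff.2 hw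
  set K : Set ℝ := (fun t : ℝ => t • w) ⁻¹' S with hK
  have hemb : Topology.IsClosedEmbedding fun t : ℝ => t • w := isClosedEmbedding_smul_left hw
  have hKc : IsCompact K := hemb.isCompact_preimage hcomp
  have hmem : r / ‖w‖ ∈ K := by
    refine hball _ (W.smul_mem _ hwW) ?_
    rw [norm_smul, Real.norm_of_nonneg (by positivity)]
    field_simp
    exact le_rfl
  obtain ⟨ρ, hρ, hmax⟩ := hKc.exists_isGreatest ⟨_, hmem⟩
  refine ⟨ρ, lt_of_lt_of_le (by positivity) (hmax hmem), hρ, fun t ht htS => ?_⟩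
  exact absurd (hmax (show t ∈ K from htS)) (not_le.2 ht)

theorem finrank_vectorSpan_exposed_eq_one {W : Submodule ℝ E} (hW : Module.finrank ℝ W = 2)
    {S : Set E} (hSW : S ⊆ W) {l : StrongDual ℝ E} {x : E} (hx : x ∈ S) (hlx : 0 < l x)
    (hle : ∀ y ∈ S, l y ≤ l x) (hne : {z ∈ S | ∀ y ∈ S, l y ≤ l z} ≠ {x}) :
    Module.finrank ℝ (vectorSpan ℝ {z ∈ S | ∀ y ∈ S, l y ≤ l z}) = 1 := by
  set F := {z ∈ S | ∀ y ∈ S, l y ≤ l z} with hF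
  have : FiniteDimensional ℝ W := Module.finite_of_finrank_pos (by omega)
  have hxF : x ∈ F := ⟨hx, hle⟩
  have hval : ∀ z ∈ F, l z = l x := fun z hz => le_antisymm (hle z hz.1) (hz.2 x hx)
  have hsub : vectorSpan ℝ F ≤ W ⊓ LinearMap.ker (l : E →ₗ[ℝ] ℝ) := by
    rw [vectorSpan_def, Submodule.span_le]
    rintro _ ⟨p, hp, q, hq, rfl⟩
    refine ⟨W.sub_mem (hSW hp.1) (hSW hq.1), ?_⟩
    simp [hval p hp, hval q hq]
  have hlt : vectorSpan ℝ F < W := by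
    refine lt_of_le_of_ne (hsub.trans inf_le_left) fun h => ?_
    have hxk := (hsub (h ▸ hSW hx : x ∈ vectorSpan ℝ F)).2
    simp at hxk
    linarith
  have h1 := Submodule.finrank_lt_finrank_of_lt hlt
  have : FiniteDimensional ℝ (vectorSpan ℝ F) := Submodule.finiteDimensional_of_le hlt.le
  have h2 : Module.finrank ℝ (vectorSpan ℝ F) ≠ 0 := by
    intro h
    rw [Submodule.finrank_eq_zero, vectorSpan_eq_bot_iff_subsingleton] at h
    exact hne (h.eq_singleton_of_mem hxF)
  omega

end Support

section Counting

variable {d : ℕ} {ι : Type*} [Fintype ι]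

theorem finite_edges_convexHull_range_inter (a : ι → Euc d) (W : Submodule ℝ (Euc d)) :
    {F : Set (Euc d) | IsExposed ℝ (convexHull ℝ (range a) ∩ W) F ∧
      Module.finrank ℝ (vectorSpan ℝ F) = 1}.Finite :=
  (finite_exposed_convexHull_range_inter a W).subset fun _ hF => hF.1

theorem isCompact_convexHull_range_inter (a : ι → Euc d) (W : Submodule ℝ (Euc d)) :
    IsCompact (convexHull ℝ (range a) ∩ (W : Set (Euc d))) :=
  ((finite_range a).isCompact_convexHull ℝ).inter_right W.closed_of_finiteDimensional

/-- Among infinitely many rays, one leaves the polygon through a point of an edge, which is given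
here by its supporting functional `l`. -/
theorem exists_edge_meeting_ray (a : ι → Euc d) {W : Submodule ℝ (Euc d)}
    (hW : Module.finrank ℝ W = 2) {r : ℝ} (hr : 0 < r)
    (hball : ∀ x ∈ W, ‖x‖ ≤ r → x ∈ convexHull ℝ (range a))
    {p q : Euc d} (hp : p ∈ W) (hq : q ∈ W) (hli : LinearIndependent ℝ ![p, q])
    {T : Set ℝ} (hT : T.Infinite) :
    ∃ τ ∈ T, ∃ ρ : ℝ, 0 < ρ ∧ ∃ l : StrongDual ℝ (Euc d),
      ρ • (τ • p - q) ∈ convexHull ℝ (range a) ∩ (W : Set (Euc d)) ∧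
      0 < l (ρ • (τ • p - q)) ∧
      (∀ y ∈ convexHull ℝ (range a) ∩ (W : Set (Euc d)), l y ≤ l (ρ • (τ • p - q))) ∧
      Module.finrank ℝ (vectorSpan ℝ {z ∈ convexHull ℝ (range a) ∩ (W : Set (Euc d)) |
        ∀ y ∈ convexHull ℝ (range a) ∩ (W : Set (Euc d)), l y ≤ l z}) = 1 := by
  rw [LinearIndependent.pair_iff] at hli
  set S := convexHull ℝ (range a) ∩ (W : Set (Euc d)) with hS
  have hball' : ∀ x ∈ W, ‖x‖ ≤ r → x ∈ S := fun x hx hxr => ⟨hball x hx hxr, hx⟩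
  have hSconv : Convex ℝ S := (convex_convexHull ℝ _).inter W.convex
  have hwW : ∀ τ : ℝ, τ • p - q ∈ W := fun τ => W.sub_mem (W.smul_mem _ hp) hq
  have hw0 : ∀ τ : ℝ, τ • p - q ≠ 0 := fun τ h => by
    have := (hli τ (-1) (by rw [← h]; module)).2
    norm_num at this
  have hray : ∀ τ : ℝ, ∃ ρ : ℝ, 0 < ρ ∧ ρ • (τ • p - q) ∈ S ∧
      ∃ l : StrongDual ℝ (Euc d), 0 < l (ρ • (τ • p - q)) ∧
        ∀ y ∈ S, l y ≤ l (ρ • (τ • p - q)) := by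
    intro τ
    obtain ⟨ρ, hρ, hmem, hout⟩ := exists_pos_smul_mem_forall_smul_notMem
      (isCompact_convexHull_range_inter a W) hr hball' (hwW τ) (hw0 τ)
    obtain ⟨l, hl, hle⟩ := exists_support_of_forall_smul_notMem hSconv hr hball'
      (W.smul_mem ρ (hwW τ)) fun t ht => by
        rw [smul_smul]
        exact hout _ (by nlinarith)
    exact ⟨ρ, hρ, hmem, l, hl, fun y hy => hle y hy hy.2⟩
  choose ρ hρ hmem l hl hle using hray
  by_contra! hcon
  have hsing : ∀ τ ∈ T, {z ∈ S | ∀ y ∈ S, l τ y ≤ l τ z} = {ρ τ • (τ • p - q)} := by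
    intro τ hτ
    by_contra hne
    exact hcon τ hτ (ρ τ) (hρ τ) (l τ) (hmem τ) (hl τ) (hle τ)
      (finrank_vectorSpan_exposed_eq_one hW inter_subset_right (hmem τ) (hl τ) (hle τ) hne)
  refine Set.infinite_of_injOn_mapsTo (f := fun τ => ({ρ τ • (τ • p - q)} : Set (Euc d)))
    ?_ ?_ hT (finite_exposed_convexHull_range_inter a W)
  · intro τ _ σ _ h
    have h := Set.singleton_injective h
    have h0 := hli (ρ τ * τ - ρ σ * σ) (ρ σ - ρ τ) (by
      rw [← sub_eq_zero] at h
      rw [← h]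
      module)
    have h1 : ρ σ = ρ τ := by linarith [h0.2]
    have h2 := h0.1
    rw [h1, ← mul_sub] at h2
    rcases mul_eq_zero.1 h2 with h3 | h3
    · exact absurd h3 (hρ τ).ne'
    · linarith
  · intro τ hτ _
    exact ⟨l τ, (hsing τ hτ).symm⟩

/-- If the radial function of the polygon is strictly convex between the blocks `T i` of
directions, then distinct blocks meet distinct edges. -/
theorem le_edgeCount_of_separated (a : ι → Euc d) {W : Submodule ℝ (Euc d)}
    (hW : Module.finrank ℝ W = 2) {r : ℝ} (hr : 0 < r)
    (hball : ∀ x ∈ W, ‖x‖ ≤ r → x ∈ convexHull ℝ (range a))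
    {p q : Euc d} (hp : p ∈ W) (hq : q ∈ W) (hli : LinearIndependent ℝ ![p, q])
    {N : ℕ} (T : Fin N → Set ℝ) (hT : ∀ i, (T i).Infinite)
    (hsep : ∀ i j, i ≠ j → ∀ τ ∈ T i, ∀ σ ∈ T j, ∀ ρ ρ' : ℝ, 0 < ρ → 0 < ρ' →
      ρ • (τ • p - q) ∈ convexHull ℝ (range a) → ρ' • (σ • p - q) ∈ convexHull ℝ (range a) →
      ∃ m : ℝ, 0 < m ∧ m • (((τ + σ) / 2) • p - q) ∈ convexHull ℝ (range a) ∧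
        m⁻¹ < (ρ⁻¹ + ρ'⁻¹) / 2) :
    N ≤ edgeCount (convexHull ℝ (range a) ∩ (W : Set (Euc d))) := by
  choose τ hτ ρ hρ l hmem hl hle hfin using fun i =>
    exists_edge_meeting_ray a hW hr hball hp hq hli (hT i)
  set S := convexHull ℝ (range a) ∩ (W : Set (Euc d)) with hS
  set F : Fin N → Set (Euc d) := fun i => {z ∈ S | ∀ y ∈ S, l i y ≤ l i z} with hF
  have hinj : Function.Injective F := by
    intro i j hij
    by_contra hne
    obtain ⟨m, hm, hmS, hlt⟩ :=
      hsep i j hne (τ i) (hτ i) (τ j) (hτ j) (ρ i) (ρ j) (hρ i) (hρ j) (hmem i).1 (hmem j).1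
    have hji : ρ j • (τ j • p - q) ∈ F i := hij ▸ ⟨hmem j, hle j⟩
    have heq : l i (ρ j • (τ j • p - q)) = l i (ρ i • (τ i • p - q)) :=
      le_antisymm (hle i _ (hmem j)) (hji.2 _ (hmem i))
    have hmid := hle i _ ⟨hmS, W.smul_mem _ (W.sub_mem (W.smul_mem _ hp) hq)⟩
    have hli := hl i
    simp only [map_smul, map_sub, smul_eq_mul] at heq hmid hli
    set P := l i p
    set Q := l i q
    set c := ρ i * (τ i * P - Q)
    have e1 : τ i * P - Q = c * (ρ i)⁻¹ := by
      have := (hρ i).ne'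
      simp only [c]
      field_simp
    have e2 : τ j * P - Q = c * (ρ j)⁻¹ := by
      have := (hρ j).ne'
      rw [← heq]
      field_simp
    have e3 : (τ i + τ j) / 2 * P - Q = c * (((ρ i)⁻¹ + (ρ j)⁻¹) / 2) := by
      linear_combination e1 / 2 + e2 / 2
    rw [e3] at hmid
    have h5 : m * (((ρ i)⁻¹ + (ρ j)⁻¹) / 2) ≤ 1 := by
      by_contra! h
      nlinarith
    have h6 : m * m⁻¹ < m * (((ρ i)⁻¹ + (ρ j)⁻¹) / 2) := mul_lt_mul_of_pos_left hlt hm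
    rw [mul_inv_cancel₀ hm.ne'] at h6
    linarith
  have hcard : (range F).ncard = N := by
    rw [← image_univ, ncard_image_of_injective _ hinj, ncard_univ, Nat.card_fin]
  rw [← hcard]
  refine ncard_le_ncard ?_ (finite_edges_convexHull_range_inter a W)
  rintro _ ⟨i, rfl⟩
  exact ⟨fun _ => ⟨l i, rfl⟩, hfin i⟩

end Counting

section L1

variable {d : ℕ}

/-- The `j`-th standard basis vector, and `0` if there is none. -/
def stdVec (d j : ℕ) : Euc d := if h : j < d then EuclideanSpace.single ⟨j, h⟩ 1 else 0

theorem stdVec_val (j : Fin d) : stdVec d j = EuclideanSpace.single j 1 := by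
  simp [stdVec]

theorem sum_smul_stdVec (x : Euc d) : ∑ j : Fin d, x j • stdVec d j = x := by
  ext i
  simp [stdVec_val, Finset.sum_apply, Pi.single_apply]

theorem l1norm_nonneg (x : Euc d) : 0 ≤ l1norm x := Finset.sum_nonneg fun _ _ => abs_nonneg _

theorem l1norm_add_le (x y : Euc d) : l1norm (x + y) ≤ l1norm x + l1norm y := by
  unfold l1norm
  rw [← Finset.sum_add_distrib]
  exact Finset.sum_le_sum fun i _ => abs_add_le _ _

theorem l1norm_smul (c : ℝ) (x : Euc d) : l1norm (c • x) = |c| * l1norm x := by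
  simp [l1norm, abs_mul, Finset.mul_sum]

theorem l1norm_neg (x : Euc d) : l1norm (-x) = l1norm x := by
  simp [l1norm]

theorem l1norm_sub_le (x y : Euc d) : l1norm (x - y) ≤ l1norm x + l1norm y := by
  rw [sub_eq_add_neg, ← l1norm_neg y]
  exact l1norm_add_le _ _

theorem l1norm_sum_le {κ : Type*} (s : Finset κ) (f : κ → Euc d) :
    l1norm (∑ i ∈ s, f i) ≤ ∑ i ∈ s, l1norm (f i) :=
  Finset.le_sum_of_subadditive l1norm (by simp [l1norm]) l1norm_add_le s f

theorem l1norm_stdVec_le (j : ℕ) : l1norm (stdVec d j) ≤ 1 := by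
  unfold stdVec
  split_ifs with h
  · simp [l1norm, apply_ite abs]
  · simp [l1norm]

theorem l1norm_le_mul_norm (x : Euc d) : l1norm x ≤ d * ‖x‖ := by
  have h : l1norm x ≤ ∑ _i : Fin d, ‖x‖ :=
    Finset.sum_le_sum fun i _ => by simpa using PiLp.norm_apply_le x i
  simpa using h

theorem abs_apply_le_mul_l1norm (f : StrongDual ℝ (Euc d)) {B : ℝ}
    (hB : ∀ j < d, |f (stdVec d j)| ≤ B) (x : Euc d) : |f x| ≤ B * l1norm x := by
  have h : f x = ∑ j : Fin d, x j * f (stdVec d j) := by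
    conv_lhs => rw [← sum_smul_stdVec x]
    simp
  rw [h, l1norm, Finset.mul_sum]
  refine (Finset.abs_sum_le_sum_abs _ _).trans (Finset.sum_le_sum fun j _ => ?_)
  rw [abs_mul, mul_comm]
  exact mul_le_mul_of_nonneg_right (hB j j.2) (abs_nonneg _)

variable {ι : Type*} [Fintype ι] [Nonempty ι]

/-- If the polytope `conv A` contains the `ℓ₁` ball of radius `1 / K` (in its dual form `hK`), an
`ℓ₁`-perturbation of its vertices of size `ε` shrinks it at most by the factor `1 - K * ε`. -/
theorem mem_convexHull_of_l1_perturbation {A a : ι → Euc d} {K ε : ℝ}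
    (hK : ∀ (f : StrongDual ℝ (Euc d)) (σ : ℝ), (∀ i, f (A i) ≤ σ) →
      ∀ j < d, |f (stdVec d j)| ≤ K * σ)
    (ha : ∀ i, l1norm (a i - A i) ≤ ε) {x : Euc d}
    (hx : ∀ (f : StrongDual ℝ (Euc d)) (σ : ℝ), 0 ≤ σ → (∀ i, f (A i) ≤ σ) →
      f x ≤ (1 - K * ε) * σ) (hd : 0 < d) (hKpos : 0 < K) :
    x ∈ convexHull ℝ (range a) := by
  by_contra hx0
  obtain ⟨f, u, hu, hux⟩ := geometric_hahn_banach_closed_point (convex_convexHull ℝ (range a))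
    ((finite_range a).isClosed_convexHull ℝ) hx0
  obtain ⟨i, hi⟩ := Finite.exists_max fun i => f (A i)
  have hB := hK f (f (A i)) hi
  have hσ : 0 ≤ f (A i) := by
    have := (abs_nonneg _).trans (hB 0 hd)
    exact nonneg_of_mul_nonneg_right this hKpos
  have h1 := (abs_le.1 (abs_apply_le_mul_l1norm f hB (a i - A i))).1
  have h2 : K * f (A i) * l1norm (a i - A i) ≤ K * f (A i) * ε :=
    mul_le_mul_of_nonneg_left (ha i) (by positivity)
  have h3 := hu (a i) (subset_convexHull ℝ _ (mem_range_self i))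
  have h4 := hx f _ hσ hi
  rw [map_sub] at h1
  linarith

theorem mem_convexHull_of_l1norm_le {A a : ι → Euc d} {K ε : ℝ}
    (hK : ∀ (f : StrongDual ℝ (Euc d)) (σ : ℝ), (∀ i, f (A i) ≤ σ) →
      ∀ j < d, |f (stdVec d j)| ≤ K * σ)
    (ha : ∀ i, l1norm (a i - A i) ≤ ε) (hd : 0 < d) (hKpos : 0 < K) {x : Euc d}
    (hx : K * l1norm x ≤ 1 - K * ε) : x ∈ convexHull ℝ (range a) := by
  refine mem_convexHull_of_l1_perturbation hK ha (fun f σ hσ hf => ?_) hd hKpos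
  calc f x ≤ K * σ * l1norm x := (le_abs_self _).trans (abs_apply_le_mul_l1norm f (hK f σ hf) x)
    _ = K * l1norm x * σ := by ring
    _ ≤ (1 - K * ε) * σ := mul_le_mul_of_nonneg_right hx hσ

theorem exists_ball_subset_convexHull {A a : ι → Euc d} {K ε : ℝ}
    (hK : ∀ (f : StrongDual ℝ (Euc d)) (σ : ℝ), (∀ i, f (A i) ≤ σ) →
      ∀ j < d, |f (stdVec d j)| ≤ K * σ)
    (ha : ∀ i, l1norm (a i - A i) ≤ ε) (hd : 0 < d) (hKpos : 0 < K) (hKε : K * ε < 1) :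
    ∃ r : ℝ, 0 < r ∧ ∀ x : Euc d, ‖x‖ ≤ r → x ∈ convexHull ℝ (range a) := by
  have hd' : (0 : ℝ) < d := by exact_mod_cast hd
  refine ⟨(1 - K * ε) / (K * d), div_pos (by linarith) (by positivity), fun x hx => ?_⟩
  refine mem_convexHull_of_l1norm_le hK ha hd hKpos ?_
  rw [le_div_iff₀ (by positivity)] at hx
  have := mul_le_mul_of_nonneg_left (l1norm_le_mul_norm x) hKpos.le
  nlinarith

end L1

section Tent

/-- The offset of the parabola, chosen so that the constraints below have the origin as a deep
interior point. -/
def parabolaOffset (k : ℕ) : ℝ := 1 + ∑ j ∈ Finset.range k, 1 / 4 ^ (j + 1)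

theorem parabolaOffset_eq (k : ℕ) : parabolaOffset k = 4 / 3 - 1 / (3 * 4 ^ k) := by
  unfold parabolaOffset
  induction k with
  | zero => norm_num
  | succ k ih =>
    rw [Finset.sum_range_succ, ← add_assoc, ih]
    field_simp
    ring

theorem parabolaOffset_le (k : ℕ) : parabolaOffset k ≤ 4 / 3 := by
  rw [parabolaOffset_eq]
  have : (0 : ℝ) ≤ 1 / (3 * 4 ^ k) := by positivity
  linarith

theorem one_le_parabolaOffset (k : ℕ) : 1 ≤ parabolaOffset k := by
  unfold parabolaOffset
  have : (0 : ℝ) ≤ ∑ j ∈ Finset.range k, 1 / 4 ^ (j + 1) :=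
    Finset.sum_nonneg fun j _ => by positivity
  linarith

theorem sum_two_div_four_pow (k : ℕ) :
    ∑ j ∈ Finset.range k, (2 : ℝ) / 4 ^ (j + 1) = 2 * (parabolaOffset k - 1) := by
  unfold parabolaOffset
  rw [add_sub_cancel_left, Finset.mul_sum]
  exact Finset.sum_congr rfl fun j _ => by ring

variable {k : ℕ} {t : ℕ → ℝ} {s : ℝ}

theorem abs_le_of_tent_le (hk : 0 < k) (h1 : ∀ j < k, 2 * t j - t (j + 1) ≤ s)
    (h2 : ∀ j < k, -2 * t j - t (j + 1) ≤ s) (h3 : t k ≤ s) : ∀ j ≤ k, |t j| ≤ s := by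
  have hle : ∀ j ≤ k, t j ≤ s := by
    intro j hj
    induction hj using Nat.decreasingInduction with
    | self => exact h3
    | of_succ j hj ih => linarith [h1 j hj]
  intro j hj
  refine abs_le.2 ⟨?_, hle j hj⟩
  rcases hj.lt_or_eq with hj | rfl
  · linarith [h2 j hj, hle (j + 1) hj]
  · obtain ⟨m, rfl⟩ := Nat.exists_eq_succ_of_ne_zero hk.ne'
    linarith [h1 m (Nat.lt_succ_self m), h2 m (Nat.lt_succ_self m)]

theorem sq_le_sum_of_tent_le (h1 : ∀ j < k, 2 * t j - t (j + 1) ≤ s)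
    (h2 : ∀ j < k, -2 * t j - t (j + 1) ≤ s) :
    t 0 ^ 2 ≤ s * ∑ j ∈ Finset.range k, (s + 2 * t (j + 1)) / 4 ^ (j + 1) + t k ^ 2 / 4 ^ k := by
  induction k with
  | zero => simp
  | succ k ih =>
    have ih := ih (fun j hj => h1 j (hj.trans (Nat.lt_succ_self k)))
      (fun j hj => h2 j (hj.trans (Nat.lt_succ_self k)))
    have e1 := h1 k (Nat.lt_succ_self k)
    have e2 := h2 k (Nat.lt_succ_self k)
    have hsq : t k ^ 2 ≤ ((s + t (k + 1)) / 2) ^ 2 :=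
      sq_le_sq' (by linarith) (by linarith)
    have hdiv : t k ^ 2 / 4 ^ k ≤ ((s + t (k + 1)) / 2) ^ 2 / 4 ^ k := by gcongr
    have heq : ((s + t (k + 1)) / 2) ^ 2 / 4 ^ k =
        s * ((s + 2 * t (k + 1)) / 4 ^ (k + 1)) + t (k + 1) ^ 2 / 4 ^ (k + 1) := by
      field_simp
      ring
    rw [Finset.sum_range_succ, mul_add]
    linarith

theorem sum_add_two_mul_div (k : ℕ) (t : ℕ → ℝ) (s : ℝ) :
    ∑ j ∈ Finset.range k, (s + 2 * t (j + 1)) / 4 ^ (j + 1) =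
      s * (parabolaOffset k - 1) + ∑ j ∈ Finset.range k, 2 / 4 ^ (j + 1) * t (j + 1) := by
  unfold parabolaOffset
  rw [add_sub_cancel_left, Finset.mul_sum, ← Finset.sum_add_distrib]
  exact Finset.sum_congr rfl fun j _ => by ring

/-- The tent map iterated on `[-1, 1]`. -/
def tentIter (τ : ℝ) : ℕ → ℝ
  | 0 => τ
  | j + 1 => 2 * |tentIter τ j| - 1

theorem abs_tentIter_le {τ : ℝ} (hτ : |τ| ≤ 1) (j : ℕ) : |tentIter τ j| ≤ 1 := by
  induction j with
  | zero => exact hτ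
  | succ j ih =>
    have := abs_nonneg (tentIter τ j)
    exact abs_le.2 ⟨by simp only [tentIter]; linarith, by simp only [tentIter]; linarith⟩

theorem sq_eq_sum_tentIter (τ : ℝ) (k : ℕ) :
    τ ^ 2 = ∑ j ∈ Finset.range k, (1 + 2 * tentIter τ (j + 1)) / 4 ^ (j + 1) +
      tentIter τ k ^ 2 / 4 ^ k := by
  induction k with
  | zero => simp [tentIter]
  | succ k ih =>
    rw [Finset.sum_range_succ]
    conv_lhs => rw [ih]
    have h : tentIter τ k ^ 2 = ((1 + tentIter τ (k + 1)) / 2) ^ 2 := by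
      simp only [tentIter]
      rw [← sq_abs]
      ring
    rw [h]
    field_simp
    ring

end Tent

section Parabola

/-- Vertices of a polytope whose polar projects onto an approximation of the region above a
parabola: the polar is cut out by the tent inequalities `±2 t j - t (j + 1) ≤ 1` for `j < k`,
`t k ≤ 1`, `∑ 2 / 4 ^ (j + 1) * t (j + 1) - v ≤ 1` and `v ≤ 1` (up to the scale `3`), with `t j` and
`v` the coordinates `j ≤ k` and `k + 1`. -/
def parabolaVertex (k : ℕ) : (Fin k × Bool) ⊕ Fin 3 → Euc (k + 2)
  | .inl (j, true) => (1 / 3 : ℝ) • ((2 : ℝ) • stdVec (k + 2) j - stdVec (k + 2) (j + 1))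
  | .inl (j, false) => (1 / 3 : ℝ) • ((-2 : ℝ) • stdVec (k + 2) j - stdVec (k + 2) (j + 1))
  | .inr 0 => (1 / 3 : ℝ) • stdVec (k + 2) k
  | .inr 1 => (1 / 3 : ℝ) • (∑ j ∈ Finset.range k, ((2 : ℝ) / 4 ^ (j + 1)) • stdVec (k + 2) (j + 1)
      - stdVec (k + 2) (k + 1))
  | .inr 2 => (1 / 3 : ℝ) • stdVec (k + 2) (k + 1)

theorem l1norm_smul_stdVec_le {d : ℕ} (c : ℝ) (j : ℕ) : l1norm (c • stdVec d j) ≤ |c| := by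
  rw [l1norm_smul]
  exact mul_le_of_le_one_right (abs_nonneg c) (l1norm_stdVec_le j)

theorem l1norm_parabolaVertex_le (k : ℕ) (i : (Fin k × Bool) ⊕ Fin 3) :
    l1norm (parabolaVertex k i) ≤ 1 := by
  have hthird : ∀ x : Euc (k + 2), l1norm x ≤ 3 → l1norm ((1 / 3 : ℝ) • x) ≤ 1 := fun x hx => by
    rw [l1norm_smul, abs_of_pos (by norm_num)]
    linarith
  have hsum : l1norm (∑ j ∈ Finset.range k, ((2 : ℝ) / 4 ^ (j + 1)) • stdVec (k + 2) (j + 1))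
      ≤ 2 := by
    refine (l1norm_sum_le _ _).trans ?_
    calc ∑ j ∈ Finset.range k, l1norm (((2 : ℝ) / 4 ^ (j + 1)) • stdVec (k + 2) (j + 1))
        ≤ ∑ j ∈ Finset.range k, (2 : ℝ) / 4 ^ (j + 1) := Finset.sum_le_sum fun j _ =>
          (l1norm_smul_stdVec_le _ _).trans_eq (abs_of_pos (by positivity))
      _ ≤ 2 := by
        rw [sum_two_div_four_pow]
        linarith [parabolaOffset_le k]
  match i with
  | .inl (j, true) =>
    refine hthird _ ((l1norm_sub_le _ _).trans ?_)
    have := l1norm_smul_stdVec_le (d := k + 2) 2 j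
    rw [abs_of_pos two_pos] at this
    linarith [l1norm_stdVec_le (d := k + 2) (j + 1)]
  | .inl (j, false) =>
    refine hthird _ ((l1norm_sub_le _ _).trans ?_)
    have := l1norm_smul_stdVec_le (d := k + 2) (-2) j
    rw [abs_neg, abs_of_pos two_pos] at this
    linarith [l1norm_stdVec_le (d := k + 2) (j + 1)]
  | .inr 0 => exact hthird _ ((l1norm_stdVec_le _).trans (by norm_num))
  | .inr 1 =>
    refine hthird _ ((l1norm_sub_le _ _).trans ?_)
    linarith [l1norm_stdVec_le (d := k + 2) (k + 1)]
  | .inr 2 => exact hthird _ ((l1norm_stdVec_le _).trans (by norm_num))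

variable {k : ℕ}

theorem forall_apply_parabolaVertex_le_iff (f : StrongDual ℝ (Euc (k + 2))) (σ : ℝ) :
    (∀ i, f (parabolaVertex k i) ≤ σ) ↔
      (∀ j < k, 2 * f (stdVec (k + 2) j) - f (stdVec (k + 2) (j + 1)) ≤ 3 * σ) ∧
      (∀ j < k, -2 * f (stdVec (k + 2) j) - f (stdVec (k + 2) (j + 1)) ≤ 3 * σ) ∧
      f (stdVec (k + 2) k) ≤ 3 * σ ∧
      ∑ j ∈ Finset.range k, 2 / 4 ^ (j + 1) * f (stdVec (k + 2) (j + 1))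
        - f (stdVec (k + 2) (k + 1)) ≤ 3 * σ ∧
      f (stdVec (k + 2) (k + 1)) ≤ 3 * σ := by
  constructor
  · intro h
    refine ⟨fun j hj => ?_, fun j hj => ?_, ?_, ?_, ?_⟩
    · have := h (.inl (⟨j, hj⟩, true))
      simp only [parabolaVertex, map_smul, map_sub, smul_eq_mul] at this
      linarith
    · have := h (.inl (⟨j, hj⟩, false))
      simp only [parabolaVertex, map_smul, map_sub, smul_eq_mul] at this
      linarith
    · have := h (.inr 0)
      simp only [parabolaVertex, map_smul, smul_eq_mul] at this
      linarith
    · have := h (.inr 1)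
      simp only [parabolaVertex, map_smul, map_sub, map_sum, smul_eq_mul] at this
      linarith
    · have := h (.inr 2)
      simp only [parabolaVertex, map_smul, smul_eq_mul] at this
      linarith
  · rintro ⟨h1, h2, h3, h4, h5⟩ i
    match i with
    | .inl (j, true) =>
      simp only [parabolaVertex, map_smul, map_sub, smul_eq_mul]
      linarith [h1 j j.2]
    | .inl (j, false) =>
      simp only [parabolaVertex, map_smul, map_sub, smul_eq_mul]
      linarith [h2 j j.2]
    | .inr 0 =>
      simp only [parabolaVertex, map_smul, smul_eq_mul]
      linarith
    | .inr 1 =>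
      simp only [parabolaVertex, map_smul, map_sub, map_sum, smul_eq_mul]
      linarith
    | .inr 2 =>
      simp only [parabolaVertex, map_smul, smul_eq_mul]
      linarith

theorem abs_apply_stdVec_le_of_parabolaVertex (hk : 0 < k) (f : StrongDual ℝ (Euc (k + 2)))
    (σ : ℝ) (hf : ∀ i, f (parabolaVertex k i) ≤ σ) :
    ∀ j < k + 2, |f (stdVec (k + 2) j)| ≤ 5 * σ := by
  obtain ⟨h1, h2, h3, h4, h5⟩ := (forall_apply_parabolaVertex_le_iff f σ).1 hf
  have habs := abs_le_of_tent_le (t := fun j => f (stdVec (k + 2) j)) hk h1 h2 h3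
  have hσ : 0 ≤ 3 * σ := (abs_nonneg _).trans (habs 0 hk.le)
  intro j hj
  rcases Nat.lt_succ_iff_lt_or_eq.1 hj with hj | rfl
  · exact (habs j (Nat.lt_succ_iff.1 hj)).trans (by linarith)
  · have hsum : -(∑ j ∈ Finset.range k, 2 / 4 ^ (j + 1) * (3 * σ)) ≤
        ∑ j ∈ Finset.range k, 2 / 4 ^ (j + 1) * f (stdVec (k + 2) (j + 1)) := by
      rw [← Finset.sum_neg_distrib]
      refine Finset.sum_le_sum fun j hj => ?_
      rw [← mul_neg]
      exact mul_le_mul_of_nonneg_left (abs_le.1 (habs (j + 1) (Finset.mem_range.1 hj))).1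
        (by positivity)
    rw [← Finset.sum_mul, sum_two_div_four_pow] at hsum
    have hoff : 2 * (parabolaOffset k - 1) * (3 * σ) ≤ 2 * (4 / 3 - 1) * (3 * σ) := by
      have := parabolaOffset_le k
      gcongr
    exact abs_le.2 ⟨by linarith, by linarith⟩

theorem tangent_le_of_parabolaVertex (hk : 0 < k) (f : StrongDual ℝ (Euc (k + 2)))
    {σ : ℝ} (hσ : 0 ≤ σ) (hf : ∀ i, f (parabolaVertex k i) ≤ σ) (τ : ℝ) :
    2 * τ * f (stdVec (k + 2) 0) - f (stdVec (k + 2) (k + 1)) ≤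
      3 * σ * (τ ^ 2 + parabolaOffset k + 1 / 4 ^ k) := by
  have hbound := abs_apply_stdVec_le_of_parabolaVertex hk f σ hf
  obtain ⟨h1, h2, h3, h4, h5⟩ := (forall_apply_parabolaVertex_le_iff f σ).1 hf
  have habs := abs_le_of_tent_le (t := fun j => f (stdVec (k + 2) j)) hk h1 h2 h3
  have hsq := sq_le_sum_of_tent_le (t := fun j => f (stdVec (k + 2) j)) h1 h2
  simp only [sum_add_two_mul_div k (fun j => f (stdVec (k + 2) j))] at hsq
  have hlast : f (stdVec (k + 2) k) ^ 2 / 4 ^ k ≤ (3 * σ) ^ 2 * (1 / 4 ^ k) := by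
    have := abs_le.1 (habs k le_rfl)
    rw [div_eq_mul_one_div]
    exact mul_le_mul_of_nonneg_right (sq_le_sq' this.1 this.2) (by positivity)
  rcases hσ.eq_or_lt with rfl | hσ
  · have e0 := hbound 0 (by omega)
    have e1 := hbound (k + 1) (by omega)
    simp only [mul_zero, abs_nonpos_iff] at e0 e1
    simp [e0, e1]
  · have hs : 0 < 3 * σ := by linarith
    set s := 3 * σ
    set u := f (stdVec (k + 2) 0)
    set v := f (stdVec (k + 2) (k + 1))
    have h6 : u ^ 2 ≤ s * (s * parabolaOffset k + v) + s ^ 2 * (1 / 4 ^ k) := by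
      have := mul_le_mul_of_nonneg_left h4 hs.le
      nlinarith
    refine le_of_mul_le_mul_left ?_ hs
    nlinarith [sq_nonneg (u - τ * s)]

theorem exists_strongDual_apply_stdVec {d : ℕ} (c : ℕ → ℝ) :
    ∃ f : StrongDual ℝ (Euc d), ∀ j < d, f (stdVec d j) = c j := by
  refine ⟨∑ j : Fin d, c j • EuclideanSpace.proj j, fun j hj => ?_⟩
  simp [stdVec, hj]

theorem exists_tangent_of_parabolaVertex (k : ℕ) {τ : ℝ} (hτ : |τ| ≤ 1) :
    ∃ f : StrongDual ℝ (Euc (k + 2)), (∀ i, f (parabolaVertex k i) ≤ 1 / 3) ∧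
      f (stdVec (k + 2) 0) = τ ∧ f (stdVec (k + 2) (k + 1)) = τ ^ 2 - parabolaOffset k := by
  obtain ⟨f, hf⟩ := exists_strongDual_apply_stdVec (d := k + 2)
    fun j => if j = k + 1 then τ ^ 2 - parabolaOffset k else tentIter τ j
  have hf1 : ∀ j ≤ k, f (stdVec (k + 2) j) = tentIter τ j := fun j hj => by
    rw [hf j (by omega), if_neg (by omega)]
  have hf2 : f (stdVec (k + 2) (k + 1)) = τ ^ 2 - parabolaOffset k := by
    rw [hf _ (by omega), if_pos rfl]
  refine ⟨f, (forall_apply_parabolaVertex_le_iff f _).2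
    ⟨fun j hj => ?_, fun j hj => ?_, ?_, ?_, ?_⟩, hf1 0 (Nat.zero_le k), hf2⟩
  · rw [hf1 j hj.le, hf1 (j + 1) hj, tentIter]
    linarith [le_abs_self (tentIter τ j)]
  · rw [hf1 j hj.le, hf1 (j + 1) hj, tentIter]
    linarith [neg_abs_le (tentIter τ j)]
  · rw [hf1 k le_rfl]
    linarith [(abs_le.1 (abs_tentIter_le hτ k)).2]
  · have hsum : ∑ j ∈ Finset.range k, 2 / 4 ^ (j + 1) * f (stdVec (k + 2) (j + 1)) =
        ∑ j ∈ Finset.range k, 2 / 4 ^ (j + 1) * tentIter τ (j + 1) :=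
      Finset.sum_congr rfl fun j hj => by rw [hf1 (j + 1) (Finset.mem_range.1 hj)]
    have h := sq_eq_sum_tentIter τ k
    rw [sum_add_two_mul_div] at h
    have hpos : 0 ≤ tentIter τ k ^ 2 / 4 ^ k := by positivity
    rw [hsum, hf2]
    linarith
  · rw [hf2]
    have : τ ^ 2 ≤ 1 := (sq_le_one_iff_abs_le_one τ).2 hτ
    linarith [one_le_parabolaOffset k]

end Parabola

section Sections

theorem linearIndependent_stdVec_pair {d i j : ℕ} (hi : i < d) (hj : j < d) (hij : i ≠ j)
    {c : ℝ} (hc : c ≠ 0) : LinearIndependent ℝ ![c • stdVec d i, stdVec d j] := by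
  rw [LinearIndependent.pair_iff]
  intro s t h
  have hji : (⟨i, hi⟩ : Fin d) ≠ ⟨j, hj⟩ := fun h => hij (Fin.mk.inj h)
  have h1 := congrArg (fun x : Euc d => x ⟨i, hi⟩) h
  have h2 := congrArg (fun x : Euc d => x ⟨j, hj⟩) h
  simp [stdVec, hi, hj, hij, hij.symm, hc] at h1 h2
  exact ⟨h1, h2⟩

theorem finrank_span_pair_eq_two {d : ℕ} {p q : Euc d} (h : LinearIndependent ℝ ![p, q]) :
    Module.finrank ℝ (Submodule.span ℝ {p, q}) = 2 := by
  have := finrank_span_eq_card h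
  rwa [Matrix.range_cons, Matrix.range_cons, Matrix.range_empty, union_empty,
    singleton_union, Fintype.card_fin] at this

variable {ι : Type*} [Fintype ι] [Nonempty ι]

theorem le_edgeCount_parabola {k : ℕ} (hk : 0 < k) {g : ι → (Fin k × Bool) ⊕ Fin 3}
    (hg : Function.Surjective g) {a : ι → Euc (k + 2)} {ε : ℝ} (hε0 : 0 < ε) (hε : ε < 1 / 90)
    (ha : ∀ i, l1norm (a i - parabolaVertex k (g i)) ≤ ε) {N : ℕ} (hN : 0 < N)
    (hNε : N = 1 ∨ 400 * (N : ℝ) ^ 2 * (ε + 1 / 4 ^ k) ≤ 1) :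
    N ≤ edgeCount (convexHull ℝ (range a) ∩
      (Submodule.span ℝ {(2 : ℝ) • stdVec (k + 2) 0, stdVec (k + 2) (k + 1)} :
        Set (Euc (k + 2)))) := by
  have hli : LinearIndependent ℝ ![(2 : ℝ) • stdVec (k + 2) 0, stdVec (k + 2) (k + 1)] :=
    linearIndependent_stdVec_pair (by omega) (by omega) (by omega) two_ne_zero
  have hsurj : ∀ (f : StrongDual ℝ (Euc (k + 2))) (σ : ℝ),
      (∀ i, f (parabolaVertex k (g i)) ≤ σ) → ∀ i, f (parabolaVertex k i) ≤ σ := by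
    intro f σ h i
    obtain ⟨i, rfl⟩ := hg i
    exact h i
  have hK : ∀ (f : StrongDual ℝ (Euc (k + 2))) (σ : ℝ), (∀ i, f (parabolaVertex k (g i)) ≤ σ) →
      ∀ j < k + 2, |f (stdVec (k + 2) j)| ≤ 5 * σ := fun f σ hf =>
    abs_apply_stdVec_le_of_parabolaVertex hk f σ (hsurj f σ hf)
  obtain ⟨r, hr, hball⟩ := exists_ball_subset_convexHull hK ha (by omega) (by norm_num)
    (by linarith)
  have hN' : (0 : ℝ) < N := by exact_mod_cast hN
  have houter : ∀ τ ρ : ℝ, |τ| ≤ 1 → 0 < ρ →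
      ρ • (τ • (2 : ℝ) • stdVec (k + 2) 0 - stdVec (k + 2) (k + 1)) ∈ convexHull ℝ (range a) →
      3 * (τ ^ 2 + parabolaOffset k) / (1 + 5 * ε) ≤ ρ⁻¹ := by
    intro τ ρ hτ hρ hmem
    obtain ⟨f, hf, hf0, hf1⟩ := exists_tangent_of_parabolaVertex k hτ
    have hfa : ∀ i, f (a i) ≤ (1 + 5 * ε) / 3 := by
      intro i
      have h1 := (le_abs_self _).trans (abs_apply_le_mul_l1norm f
        (hK f (1 / 3) fun i => hf (g i)) (a i - parabolaVertex k (g i)))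
      rw [map_sub] at h1
      linarith [hf (g i), ha i]
    have hle : convexHull ℝ (range a) ⊆ {x | f x ≤ (1 + 5 * ε) / 3} := by
      refine convexHull_min ?_ (convex_halfSpace_le f.isLinear _)
      rintro _ ⟨i, rfl⟩
      exact hfa i
    have h := hle hmem
    simp only [mem_ofPred_eq, map_smul, map_sub, smul_eq_mul, hf0, hf1] at h
    rw [div_le_iff₀ (by linarith), inv_mul_eq_div, le_div_iff₀ hρ]
    linarith
  refine le_edgeCount_of_separated a (finrank_span_pair_eq_two hli) hr (fun x _ hx => hball x hx)
    (Submodule.subset_span (by simp)) (Submodule.subset_span (by simp)) hli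
    (fun i : Fin N => Icc ((i : ℝ) / N) (i / N + 1 / (2 * N)))
    (fun i => Icc_infinite (lt_add_of_pos_right _ (by positivity))) ?_
  intro i j hij τ hτ σ hσ ρ ρ' hρ hρ' hmem hmem'
  rcases hNε with rfl | hNε
  · exact absurd (Subsingleton.elim i j) hij
  have hunit : ∀ (i : Fin N) (τ : ℝ), τ ∈ Icc ((i : ℝ) / N) (i / N + 1 / (2 * N)) →
      0 ≤ τ ∧ τ ≤ 1 := by
    intro i τ hτ
    have hi : (i : ℝ) + 1 ≤ N := by exact_mod_cast i.2
    have h0 : (0 : ℝ) ≤ (i : ℝ) / N := by positivity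
    have h1 : (i : ℝ) / N + 1 / (2 * N) ≤ 1 := by
      rw [div_add_div _ _ hN'.ne' (by positivity), div_le_one (by positivity)]
      nlinarith
    exact ⟨h0.trans hτ.1, hτ.2.trans h1⟩
  have hgap : ∀ (i j : Fin N) (τ σ : ℝ), τ ∈ Icc ((i : ℝ) / N) (i / N + 1 / (2 * N)) →
      σ ∈ Icc ((j : ℝ) / N) (j / N + 1 / (2 * N)) → i < j → 1 / (2 * N) ≤ σ - τ := by
    intro i j τ σ hτ hσ hij
    have hij' : (i : ℝ) + 1 ≤ j := by exact_mod_cast hij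
    have h1 : (i : ℝ) / N + 1 / N ≤ j / N := by
      rw [← add_div]
      gcongr
    have h2 : (1 : ℝ) / N = 1 / (2 * N) + 1 / (2 * N) := by
      field_simp
      norm_num
    linarith [hτ.2, hσ.1]
  have hsq : 100 * (ε + 1 / 4 ^ k) ≤ (τ - σ) ^ 2 := by
    have h1 : (1 / (2 * N)) ^ 2 ≤ (τ - σ) ^ 2 := by
      have hpos : (0 : ℝ) < 1 / (2 * N) := by positivity
      rcases lt_or_gt_of_ne hij with h | h
      · nlinarith [hgap i j τ σ hτ hσ h]
      · nlinarith [hgap j i σ τ hσ hτ h]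
    refine le_trans ?_ h1
    rw [div_pow, le_div_iff₀ (by positivity)]
    linarith
  obtain ⟨hτ0, hτ1⟩ := hunit i τ hτ
  obtain ⟨hσ0, hσ1⟩ := hunit j σ hσ
  have h1 := houter τ ρ (abs_le.2 ⟨by linarith, hτ1⟩) hρ hmem
  have h2 := houter σ ρ' (abs_le.2 ⟨by linarith, hσ1⟩) hρ' hmem'
  set μ := (τ + σ) / 2 with hμ
  set V := parabolaOffset k
  have hV1 : 1 ≤ V := one_le_parabolaOffset k
  have hV2 : V ≤ 4 / 3 := parabolaOffset_le k
  set δ : ℝ := 1 / 4 ^ k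
  have hδ : 0 < δ := by positivity
  have hden : 0 < μ ^ 2 + V + δ := by positivity
  refine ⟨(1 - 5 * ε) / (3 * (μ ^ 2 + V + δ)), div_pos (by linarith) (by positivity), ?_, ?_⟩
  · refine mem_convexHull_of_l1_perturbation hK ha (fun f s hs hf => ?_) (by omega) (by norm_num)
    have h := tangent_le_of_parabolaVertex hk f hs (hsurj f s hf) μ
    simp only [map_smul, map_sub, smul_eq_mul]
    rw [div_mul_eq_mul_div, div_le_iff₀ (by positivity)]
    have := mul_le_mul_of_nonneg_left h (by linarith : (0 : ℝ) ≤ 1 - 5 * ε)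
    linarith
  · rw [inv_div]
    refine lt_of_lt_of_le ?_
      (by linarith : (3 * (τ ^ 2 + V) / (1 + 5 * ε) + 3 * (σ ^ 2 + V) / (1 + 5 * ε)) / 2 ≤ _)
    rw [← add_div, div_div, div_lt_div_iff₀ (by linarith) (by linarith)]
    have hid : τ ^ 2 + σ ^ 2 = 2 * μ ^ 2 + (τ - σ) ^ 2 / 2 := by
      rw [hμ]
      ring
    have hμ0 : 0 ≤ μ := by linarith
    have hμ1 : μ ≤ 1 := by linarith
    have hX : μ ^ 2 + V ≤ 7 / 3 := by nlinarith
    have e1 : ε * (μ ^ 2 + V) ≤ ε * (7 / 3) := mul_le_mul_of_nonneg_left hX hε0.le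
    have e2 : 100 * (ε + δ) * (1 - 5 * ε) ≤ (τ - σ) ^ 2 * (1 - 5 * ε) :=
      mul_le_mul_of_nonneg_right hsq (by linarith)
    have e3 : (ε + δ) * (17 / 18) ≤ (ε + δ) * (1 - 5 * ε) :=
      mul_le_mul_of_nonneg_left (by linarith) (by positivity)
    have e4 : δ * ε ≤ δ * (1 / 90) := mul_le_mul_of_nonneg_left hε.le hδ.le
    have e5 : 3 * (τ ^ 2 + V) + 3 * (σ ^ 2 + V) =
        6 * (μ ^ 2 + V) + 3 / 2 * (τ - σ) ^ 2 := by linear_combination 3 * hid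
    rw [e5]
    linarith

end Sections

section Simplex

/-- The standard basis vectors and the opposite of their barycenter. -/
def simplexVertex (m : ℕ) : Option (Fin m) → Euc m
  | some j => stdVec m j
  | none => -((1 / m : ℝ) • ∑ j : Fin m, stdVec m j)

theorem l1norm_simplexVertex_le {m : ℕ} (hm : 0 < m) (i : Option (Fin m)) :
    l1norm (simplexVertex m i) ≤ 1 := by
  have hm' : (0 : ℝ) < m := by exact_mod_cast hm
  cases i with
  | some j => exact l1norm_stdVec_le _
  | none =>
    rw [simplexVertex, l1norm_neg, l1norm_smul, abs_of_pos (by positivity)]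
    have h : l1norm (∑ j : Fin m, stdVec m j) ≤ ∑ _j : Fin m, (1 : ℝ) :=
      (l1norm_sum_le _ _).trans (Finset.sum_le_sum fun j _ => l1norm_stdVec_le _)
    rw [Finset.sum_const, Finset.card_univ, Fintype.card_fin, nsmul_eq_mul, mul_one] at h
    rw [one_div, inv_mul_le_iff₀ hm', mul_one]
    exact h

theorem abs_apply_stdVec_le_of_simplexVertex {m : ℕ} (hm : 0 < m) (f : StrongDual ℝ (Euc m))
    (σ : ℝ) (hf : ∀ i, f (simplexVertex m i) ≤ σ) :
    ∀ j < m, |f (stdVec m j)| ≤ (2 * m - 1) * σ := by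
  have hm' : (1 : ℝ) ≤ m := by exact_mod_cast hm
  have hsome : ∀ j : Fin m, f (stdVec m j) ≤ σ := fun j => hf (some j)
  have hnone : -∑ j : Fin m, f (stdVec m j) ≤ m * σ := by
    have h := hf none
    simp only [simplexVertex, map_neg, map_smul, map_sum, smul_eq_mul] at h
    rw [← mul_neg, one_div, inv_mul_le_iff₀ (by linarith)] at h
    exact h
  have hsum : ∑ j : Fin m, f (stdVec m j) ≤ m * σ := by
    have := Finset.sum_le_sum fun (j : Fin m) (_ : j ∈ Finset.univ) => hsome j
    simpa using this
  have hσ : 0 ≤ σ := by nlinarith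
  intro j hj
  have hrest : ∑ i ∈ Finset.univ.erase (⟨j, hj⟩ : Fin m), f (stdVec m i) ≤ (m - 1) * σ := by
    have h := Finset.sum_le_sum fun (i : Fin m) (_ : i ∈ Finset.univ.erase (⟨j, hj⟩ : Fin m)) =>
      hsome i
    rw [Finset.sum_const, Finset.card_erase_of_mem (Finset.mem_univ _), Finset.card_univ,
      Fintype.card_fin, nsmul_eq_mul, Nat.cast_sub hm, Nat.cast_one] at h
    exact h
  have hsplit := Finset.add_sum_erase Finset.univ (fun i : Fin m => f (stdVec m i))
    (Finset.mem_univ ⟨j, hj⟩)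
  simp only at hsplit
  refine abs_le.2 ⟨by linarith, ?_⟩
  have := hsome ⟨j, hj⟩
  simp only at this
  nlinarith

theorem one_le_edgeCount_simplex {m : ℕ} (hm : 2 ≤ m) {ι : Type*} [Fintype ι] [Nonempty ι]
    {g : ι → Option (Fin m)} (hg : Function.Surjective g) {a : ι → Euc m} {ε : ℝ}
    (hε : (2 * m - 1) * ε < 1) (ha : ∀ i, l1norm (a i - simplexVertex m (g i)) ≤ ε)
    {W : Submodule ℝ (Euc m)} (hW : Module.finrank ℝ W = 2) {p q : Euc m} (hp : p ∈ W)
    (hq : q ∈ W) (hli : LinearIndependent ℝ ![p, q]) :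
    1 ≤ edgeCount (convexHull ℝ (range a) ∩ (W : Set (Euc m))) := by
  have hm' : (2 : ℝ) ≤ m := by exact_mod_cast hm
  obtain ⟨r, hr, hball⟩ := exists_ball_subset_convexHull (A := fun i => simplexVertex m (g i))
    (fun f σ hf => abs_apply_stdVec_le_of_simplexVertex (by omega) f σ fun i => by
      obtain ⟨i, rfl⟩ := hg i
      exact hf i) ha (by omega) (by linarith) hε
  exact le_edgeCount_of_separated a hW hr (fun x _ hx => hball x hx) hp hq hli
    (fun _ : Fin 1 => univ) (fun _ => infinite_univ)
    fun i j hij => absurd (Subsingleton.elim i j) hij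

end Simplex

section DimensionFive

/-- The projection of `ℝ⁵` onto its last three coordinates. -/
def lastThree : Euc 5 →ₗ[ℝ] Euc 3 where
  toFun x := WithLp.toLp 2 fun j => x (Fin.natAdd 2 j)
  map_add' _ _ := rfl
  map_smul' _ _ := rfl

theorem lastThree_apply (x : Euc 5) (j : Fin 3) : lastThree x j = x (Fin.natAdd 2 j) := rfl

theorem l1norm_lastThree_le (x : Euc 5) : l1norm (lastThree x) ≤ l1norm x := by
  simp only [l1norm, lastThree_apply, Fin.sum_univ_three, Fin.sum_univ_five]
  have h0 := abs_nonneg (x 0)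
  have h1 := abs_nonneg (x 1)
  change |x 2| + |x 3| + |x 4| ≤ _
  linarith

/-- A tetrahedron around the origin of the last three coordinates, and the first basis vector. -/
def pentatopeVertex : Option (Option (Fin 3)) → Euc 5
  | none => stdVec 5 0
  | some none => -((1 / 3 : ℝ) • ∑ j : Fin 3, stdVec 5 (j + 2))
  | some (some j) => stdVec 5 (j + 2)

theorem l1norm_pentatopeVertex_le (i : Option (Option (Fin 3))) :
    l1norm (pentatopeVertex i) ≤ 1 := by
  match i with
  | none => exact l1norm_stdVec_le _
  | some (some j) => exact l1norm_stdVec_le _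
  | some none =>
    rw [pentatopeVertex, l1norm_neg, l1norm_smul, abs_of_pos (by positivity)]
    have h : l1norm (∑ j : Fin 3, stdVec 5 (j + 2)) ≤ ∑ _j : Fin 3, (1 : ℝ) :=
      (l1norm_sum_le _ _).trans (Finset.sum_le_sum fun j _ => l1norm_stdVec_le _)
    norm_num at h
    linarith

theorem lastThree_stdVec_add_two (j : Fin 3) : lastThree (stdVec 5 (j + 2)) = stdVec 3 j := by
  ext i
  fin_cases j <;> fin_cases i <;> simp [lastThree_apply, stdVec]

theorem lastThree_pentatopeVertex_some (i : Option (Fin 3)) :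
    lastThree (pentatopeVertex (some i)) = simplexVertex 3 i := by
  cases i with
  | some j => exact lastThree_stdVec_add_two j
  | none => simp [pentatopeVertex, simplexVertex, lastThree_stdVec_add_two]

theorem lastThree_pentatopeVertex_none : lastThree (pentatopeVertex none) = 0 := by
  ext i
  fin_cases i <;> simp [pentatopeVertex, lastThree_apply, stdVec]

theorem pentatopeVertex_some_apply_zero (i : Option (Fin 3)) : pentatopeVertex (some i) 0 = 0 := by
  match i with
  | some j => fin_cases j <;> simp [pentatopeVertex, stdVec]
  | none => simp [pentatopeVertex, stdVec, Fin.sum_univ_three]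

theorem finrank_ker_lastThree : Module.finrank ℝ (LinearMap.ker lastThree) = 2 := by
  have hsurj : Function.Surjective lastThree := fun y =>
    ⟨∑ j : Fin 3, y j • stdVec 5 (j + 2), by simp [lastThree_stdVec_add_two, sum_smul_stdVec]⟩
  have h := LinearMap.finrank_range_add_finrank_ker lastThree
  rw [LinearMap.range_eq_top.2 hsurj, finrank_top] at h
  simp at h
  omega

theorem one_le_edgeCount_pentatope {a : Option (Option (Fin 3)) → Euc 5} {ε : ℝ}
    (hε0 : 0 < ε) (hε : ε < 1 / 90) (ha : ∀ i, l1norm (a i - pentatopeVertex i) ≤ ε) :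
    1 ≤ edgeCount (convexHull ℝ (range a) ∩ (LinearMap.ker lastThree : Set (Euc 5))) := by
  set S := convexHull ℝ (range a) ∩ (LinearMap.ker lastThree : Set (Euc 5)) with hS
  set Q := convexHull ℝ (range fun i => a (some i)) with hQ
  have hQsub : Q ⊆ convexHull ℝ (range a) :=
    convexHull_mono (range_subset_iff.2 fun i => mem_range_self (some i))
  have hcoord : ∀ i, |a i 0 - pentatopeVertex i 0| ≤ ε := fun i =>
    (Finset.single_le_sum (f := fun j => |(a i - pentatopeVertex i) j|)
      (fun j _ => abs_nonneg _) (Finset.mem_univ 0)).trans (ha i)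
  have hlift : ∀ y : Euc 3, 5 * l1norm y ≤ 1 - 5 * ε → ∃ z ∈ Q, lastThree z = y := by
    intro y hy
    have hmem : y ∈ convexHull ℝ (range fun i => lastThree (a (some i))) := by
      refine mem_convexHull_of_l1norm_le (A := simplexVertex 3) (K := 5) (ε := ε)
        (fun f σ hf => ?_) (fun i => ?_) (by norm_num) (by norm_num) hy
      · have := abs_apply_stdVec_le_of_simplexVertex (by norm_num) f σ hf
        norm_num at this
        exact this
      · rw [← lastThree_pentatopeVertex_some, ← map_sub]
        exact (l1norm_lastThree_le _).trans (ha _)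
    have himg := lastThree.image_convexHull (range fun i => a (some i))
    rw [← range_comp] at himg
    rw [show (fun i => lastThree (a (some i))) = lastThree ∘ fun i => a (some i) from rfl,
      ← himg] at hmem
    exact hmem
  have hQ0 : ∀ z ∈ Q, |z 0| ≤ ε := by
    have hsub : Q ⊆ {z | EuclideanSpace.proj (𝕜 := ℝ) (0 : Fin 5) z ∈ Icc (-ε) ε} := by
      refine convexHull_min ?_ ((convex_Icc (-ε) ε).linear_preimage
        (EuclideanSpace.proj (𝕜 := ℝ) (0 : Fin 5)).toLinearMap)
      rintro _ ⟨i, rfl⟩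
      have := hcoord (some i)
      rw [pentatopeVertex_some_apply_zero, sub_zero] at this
      exact abs_le.1 this
    exact fun z hz => abs_le.2 (hsub hz)
  obtain ⟨p, hpQ, hp⟩ := hlift 0 (by simp [l1norm]; linarith)
  obtain ⟨z, hzQ, hz⟩ := hlift (-lastThree (a none)) (by
    have h := (l1norm_lastThree_le _).trans (ha none)
    rw [map_sub, lastThree_pentatopeVertex_none, sub_zero] at h
    rw [l1norm_neg]
    linarith)
  have hpS : p ∈ S := ⟨hQsub hpQ, hp⟩
  have hqS : (1 / 2 : ℝ) • z + (1 / 2 : ℝ) • a none ∈ S := by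
    refine ⟨convex_convexHull ℝ _ (hQsub hzQ) (subset_convexHull ℝ _ (mem_range_self none))
      (by norm_num) (by norm_num) (by norm_num), ?_⟩
    change lastThree _ = 0
    rw [map_add, map_smul, map_smul, hz]
    simp
  have hpq : p ≠ (1 / 2 : ℝ) • z + (1 / 2 : ℝ) • a none := by
    intro h
    have h0 := congrArg (fun x : Euc 5 => x 0) h
    simp only [PiLp.add_apply, PiLp.smul_apply, smul_eq_mul] at h0
    have h1 := abs_le.1 (hQ0 p hpQ)
    have h2 := abs_le.1 (hQ0 z hzQ)
    have h3 := abs_le.1 (hcoord none)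
    have h4 : pentatopeVertex none 0 = 1 := by simp [pentatopeVertex, stdVec]
    rw [h4] at h3
    linarith
  have hspan : vectorSpan ℝ S ≤ LinearMap.ker lastThree ⊓ vectorSpan ℝ (range a) := by
    refine le_inf ?_ ?_
    · rw [vectorSpan_def, Submodule.span_le]
      rintro _ ⟨x, hx, y, hy, rfl⟩
      exact Submodule.sub_mem _ hx.2 hy.2
    · rw [← direction_affineSpan ℝ (range a), ← affineSpan_convexHull, direction_affineSpan]
      exact vectorSpan_mono ℝ inter_subset_left
  have hdim : Module.finrank ℝ (vectorSpan ℝ (range a)) ≤ 4 := by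
    have := finrank_vectorSpan_range_le ℝ a (n := 4) (by simp)
    exact this
  have hnot : ¬ LinearMap.ker lastThree ≤ vectorSpan ℝ (range a) := by
    intro hle
    have htop : vectorSpan ℝ (range a) = ⊤ := by
      rw [eq_top_iff]
      intro y _
      set c : ℝ := 1 / (10 * (1 + l1norm (lastThree y))) with hc
      have hn := l1norm_nonneg (lastThree y)
      have hc0 : 0 < c := by positivity
      obtain ⟨x, hxQ, hx⟩ := hlift (c • lastThree y) (by
        rw [l1norm_smul, abs_of_pos hc0]
        have : c * l1norm (lastThree y) ≤ 1 / 10 := by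
          rw [hc, div_mul_eq_mul_div, div_le_div_iff₀ (by positivity) (by norm_num)]
          linarith
        linarith)
      have h1 : x - p ∈ vectorSpan ℝ (range a) := by
        rw [← direction_affineSpan ℝ (range a), ← affineSpan_convexHull, direction_affineSpan]
        exact vsub_mem_vectorSpan ℝ (hQsub hxQ) (hQsub hpQ)
      have h2 : x - p - c • y ∈ vectorSpan ℝ (range a) := hle (by
        rw [LinearMap.mem_ker, map_sub, map_sub, map_smul, hx, hp]
        simp)
      have h3 : c • y ∈ vectorSpan ℝ (range a) := by
        have := Submodule.sub_mem _ h1 h2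
        rwa [sub_sub_cancel] at this
      exact (Submodule.smul_mem_iff _ hc0.ne').1 h3
    rw [htop, finrank_top] at hdim
    simp at hdim
  have hlt : vectorSpan ℝ S < LinearMap.ker lastThree := by
    refine lt_of_le_of_ne (hspan.trans inf_le_left) fun h => hnot ?_
    rw [← h]
    exact hspan.trans inf_le_right
  have hfin := Submodule.finrank_lt_finrank_of_lt hlt
  rw [finrank_ker_lastThree] at hfin
  have hne : Module.finrank ℝ (vectorSpan ℝ S) ≠ 0 := by
    intro h
    rw [Submodule.finrank_eq_zero, vectorSpan_eq_bot_iff_subsingleton] at h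
    exact hpq (h hpS hqS)
  refine (ncard_pos (finite_edges_convexHull_range_inter a _)).2 ⟨S, ?_, by omega⟩
  exact IsExposed.refl S

end DimensionFive

theorem exists_surjective_of_card_le {α β : Type*} [Fintype α] [Fintype β] [Nonempty β]
    (h : Fintype.card β ≤ Fintype.card α) : ∃ g : α → β, Function.Surjective g :=
  Function.exists_surjective_iff.2 ⟨⟨fun _ => Classical.arbitrary β⟩,
    Function.Embedding.nonempty_of_card_le h⟩

theorem mul_min_le_of_one_le {d e : ℕ} (hd : d ≤ 6) (he : 1 ≤ e) (x : ℝ) :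
    1 / 240 * min x (2 ^ d) ≤ (e : ℝ) := by
  have h1 : min x (2 ^ d) ≤ (2 : ℝ) ^ 6 :=
    (min_le_right _ _).trans (pow_le_pow_right₀ (by norm_num) hd)
  have h2 : (1 : ℝ) ≤ e := by exact_mod_cast he
  linarith

/-- lower bound under adversarial `ℓ₁`-perturbations.
There is a universal `c > 0` such that for every `d ≥ 5`, with `n = 4d - 15`, there are a
two-dimensional subspace `W ⊆ ℝ^d` and points `ā₁,…,ā_n` of `ℓ₁` norm at most `1` such
that whenever `0 < ε < 1/90` and `‖a_i - ā_i‖₁ ≤ ε` for all `i`, the polygon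
`conv(a₁,…,a_n) ∩ W` has at least `c · min(1/√ε, 2^d)` edges. -/
theorem stmt_18 :
    ∃ c : ℝ, 0 < c ∧
      ∀ d : ℕ, 5 ≤ d →
      ∃ W : Submodule ℝ (Euc d), Module.finrank ℝ W = 2 ∧
      ∃ abar : Fin (4 * d - 15) → Euc d,
        (∀ i, l1norm (abar i) ≤ 1) ∧
        ∀ ε : ℝ, 0 < ε → ε < 1 / 90 →
        ∀ a : Fin (4 * d - 15) → Euc d, (∀ i, l1norm (a i - abar i) ≤ ε) →
          c * min (1 / Real.sqrt ε) (2 ^ d) ≤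
            (edgeCount (convexHull ℝ (Set.range a) ∩ ↑W) : ℝ) := by
  refine ⟨1 / 240, by norm_num, fun d hd => ?_⟩
  rcases hd.eq_or_lt with rfl | hd
  · refine ⟨LinearMap.ker lastThree, finrank_ker_lastThree, ?_⟩
    let g : Fin (4 * 5 - 15) ≃ Option (Option (Fin 3)) := Fintype.equivOfCardEq (by simp)
    refine ⟨fun i => pentatopeVertex (g i), fun i => l1norm_pentatopeVertex_le _,
      fun ε hε0 hε a ha => mul_min_le_of_one_le (by norm_num) ?_ _⟩
    have h := one_le_edgeCount_pentatope (a := a ∘ g.symm) hε0 hε fun i => by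
      simpa using ha (g.symm i)
    rwa [g.symm.surjective.range_comp] at h
  rcases (Nat.succ_le_of_lt hd).eq_or_lt with rfl | hd
  · have hli := linearIndependent_stdVec_pair (d := 6) (i := 0) (j := 1) (by norm_num) (by norm_num)
      (by norm_num) one_ne_zero
    obtain ⟨g, hg⟩ := exists_surjective_of_card_le (α := Fin (4 * 6 - 15))
      (β := Option (Fin 6)) (by simp)
    have : Nonempty (Fin (4 * 6 - 15)) := ⟨⟨0, by norm_num⟩⟩
    refine ⟨_, finrank_span_pair_eq_two hli, fun i => simplexVertex 6 (g i),
      fun i => l1norm_simplexVertex_le (by norm_num) _,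
      fun ε hε0 hε a ha => mul_min_le_of_one_le (by norm_num) ?_ _⟩
    exact one_le_edgeCount_simplex (by norm_num) hg (by norm_num; linarith) ha
      (finrank_span_pair_eq_two hli) (Submodule.subset_span (by simp))
      (Submodule.subset_span (by simp)) hli
  obtain ⟨k, rfl⟩ : ∃ k, d = k + 2 := ⟨d - 2, by omega⟩
  have hk : 5 ≤ k := by omega
  have hli := linearIndependent_stdVec_pair (d := k + 2) (i := 0) (j := k + 1) (by omega)
    (by omega) (by omega) two_ne_zero
  obtain ⟨g, hg⟩ := exists_surjective_of_card_le (α := Fin (4 * (k + 2) - 15))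
    (β := (Fin k × Bool) ⊕ Fin 3) (by simp; omega)
  have : Nonempty (Fin (4 * (k + 2) - 15)) := ⟨⟨0, by omega⟩⟩
  refine ⟨_, finrank_span_pair_eq_two hli, fun i => parabolaVertex k (g i),
    fun i => l1norm_parabolaVertex_le k _, fun ε hε0 hε a ha => ?_⟩
  have hcount : ∀ N : ℕ, 0 < N → N = 1 ∨ 400 * (N : ℝ) ^ 2 * (ε + 1 / 4 ^ k) ≤ 1 → _ :=
    fun N => le_edgeCount_parabola (N := N) (by omega) hg hε0 hε ha
  set e := edgeCount (convexHull ℝ (range a) ∩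
    (Submodule.span ℝ {(2 : ℝ) • stdVec (k + 2) 0, stdVec (k + 2) (k + 1)} : Set (Euc (k + 2))))
  have hsε : 0 < Real.sqrt ε := Real.sqrt_pos.2 hε0
  set M := min (1 / Real.sqrt ε) ((2 : ℝ) ^ k) with hM
  have hM0 : 0 ≤ M := by positivity
  have hle : min (1 / Real.sqrt ε) (2 ^ (k + 2)) ≤ 4 * M := by
    rw [hM, mul_min_of_nonneg _ _ (by norm_num : (0 : ℝ) ≤ 4)]
    refine min_le_min ?_ (by rw [pow_add]; linarith)
    have : 0 ≤ 1 / Real.sqrt ε := by positivity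
    linarith
  have hM1 : M ^ 2 * ε ≤ 1 := by
    have h : M * Real.sqrt ε ≤ 1 := (le_div_iff₀ hsε).1 (min_le_left _ _)
    calc M ^ 2 * ε = (M * Real.sqrt ε) ^ 2 := by rw [mul_pow, Real.sq_sqrt hε0.le]
      _ ≤ 1 := pow_le_one₀ (by positivity) h
  have hM2 : M ^ 2 * (1 / 4 ^ k) ≤ 1 := by
    have h : M ^ 2 ≤ (2 ^ k) ^ 2 := pow_le_pow_left₀ hM0 (min_le_right _ _) 2
    rw [mul_one_div, div_le_one (by positivity)]
    calc M ^ 2 ≤ (2 ^ k) ^ 2 := h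
      _ = 4 ^ k := by rw [← pow_mul, mul_comm, pow_mul]; norm_num
  have hone : (1 : ℝ) ≤ e := by exact_mod_cast hcount 1 one_pos (Or.inl rfl)
  have hfloor := Nat.lt_floor_add_one (M / 30)
  have hfl : (⌊M / 30⌋₊ : ℝ) ≤ e := by
    rcases Nat.eq_zero_or_pos ⌊M / 30⌋₊ with h0 | hpos
    · exact_mod_cast h0.trans_le (Nat.zero_le e)
    · have hN : (⌊M / 30⌋₊ : ℝ) ≤ M / 30 := Nat.floor_le (by positivity)
      have hNsq : (⌊M / 30⌋₊ : ℝ) ^ 2 ≤ (M / 30) ^ 2 := pow_le_pow_left₀ (by positivity) hN 2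
      have hpos' : 0 < ε + 1 / 4 ^ k := by positivity
      exact_mod_cast hcount _ hpos (Or.inr (by nlinarith))
  linarith
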